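/- Let Ω be a bounded nonempty open subset of ℂⁿ (n ≥ 1), let δ_Ω(z) denote the Euclidean distance from z to the boundary ∂Ω, and let λ denote Lebesgue measure on ℂⁿ ≅ ℝ^{2n}. Let m > 0 and let γ, γ' be real numbers with −1 < γ' ≤ γ and γ − γ' ≤ 1/m, and set μ₀ = (1 − m(γ−γ'))/(m(γ+n)+1) (so μ₀ ≥ 0). Let K : Ω × Ω → ℂ be a jointly measurable function and assume there exist ε₀ > 0 and C > 0 such that for every ε with 0 < ε ≤ ε₀: (1) ∫_Ω |K(z,ζ)|^{1+μ₀} δ_Ω(ζ)^{−μ₀γ−ε} dλ(ζ) ≤ C δ_Ω(z)^{−ε} for every z ∈ Ω, and (2) ∫_Ω |K(z,ζ)|^{1+μ₀} δ_Ω(z)^{γ'−ε} δ_Ω(ζ)^{−(1+μ₀)γ} dλ(z) ≤ C δ_Ω(ζ)^{−ε} for every ζ ∈ Ω. Then for every p with 1 ≤ p < (m(γ'+n)+2)/(1 − m(γ−γ')) and q defined by 1/q = 1/p − (1 − m(γ−γ'))/(m(γ'+n)+2), the operator Tf(z) = ∫_Ω K(z,ζ) f(ζ) dλ(ζ) is bounded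 from L^p(Ω, δ_Ω^γ) to L^q(Ω, δ_Ω^{γ'}): there is a constant C' such that for every f ∈ L^p(Ω, δ_Ω^γ), Tf is defined λ-almost everywhere on Ω and (∫_Ω |Tf|^q δ_Ω^{γ'} dλ)^{1/q} ≤ C' (∫_Ω |f|^p δ_Ω^{γ} dλ)^{1/p}. -/

import Mathlib

open MeasureTheory Metric ENNReal

open Filter Topology

/-- If weighted integrals `∫ F w^{-ε}` are bounded by `C a^{-ε}` for all small `ε > 0`, with `C`
independent of `ε`, then the unweighted integral is bounded by `C`. -/
lemma lintegral_le_of_forall_lintegral_mul_rpow_neg_le {X : Type*} [MeasurableSpace X]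
    {μ : Measure X} {F w : X → ℝ≥0∞} (hF : AEMeasurable F μ) (hw : AEMeasurable w μ)
    (hw0 : ∀ᵐ x ∂μ, w x ≠ 0) (hwt : ∀ᵐ x ∂μ, w x ≠ ⊤) {a C : ℝ≥0∞} (ha0 : a ≠ 0) (hat : a ≠ ⊤)
    {ε₀ : ℝ} (hε₀ : 0 < ε₀)
    (h : ∀ ε : ℝ, 0 < ε → ε ≤ ε₀ → ∫⁻ x, F x * w x ^ (-ε) ∂μ ≤ C * a ^ (-ε)) :
    ∫⁻ x, F x ∂μ ≤ C := by
  have key : ∀ b c : ℝ≥0∞, b ≠ 0 → b ≠ ⊤ →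
      Tendsto (fun j : ℕ ↦ c * b ^ (-(ε₀ / ((j : ℝ) + 1)))) atTop (𝓝 c) := by
    intro b c hb0 hbt
    have h0 : Tendsto (fun j : ℕ ↦ -(ε₀ / ((j : ℝ) + 1))) atTop (𝓝 0) := by
      simpa using (tendsto_const_div_atTop_nhds_zero_nat ε₀).comp (tendsto_add_atTop_nat 1) |>.neg
    have h1 : Tendsto (fun j : ℕ ↦ b ^ (-(ε₀ / ((j : ℝ) + 1)))) atTop (𝓝 1) := by
      lift b to NNReal using hbt
      have hb : b ≠ 0 := by simpa using hb0
      have h2 := (NNReal.continuousAt_rpow (x := b) (y := 0) (Or.inl hb)).tendsto.comp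
        (tendsto_const_nhds.prodMk_nhds h0)
      simp only [NNReal.rpow_zero] at h2
      simp_rw [← ENNReal.coe_rpow_of_ne_zero hb]
      simpa [Function.comp_def] using ENNReal.tendsto_coe.2 h2
    simpa using ENNReal.Tendsto.const_mul h1 (Or.inl one_ne_zero)
  calc ∫⁻ x, F x ∂μ
      = ∫⁻ x, liminf (fun j : ℕ ↦ F x * w x ^ (-(ε₀ / ((j : ℝ) + 1)))) atTop ∂μ := by
        apply lintegral_congr_ae
        filter_upwards [hw0, hwt] with x hx0 hxt
        exact (key _ _ hx0 hxt).liminf_eq.symm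
    _ ≤ liminf (fun j : ℕ ↦ ∫⁻ x, F x * w x ^ (-(ε₀ / ((j : ℝ) + 1))) ∂μ) atTop :=
        lintegral_liminf_le' fun j ↦ hF.mul (hw.pow_const _)
    _ ≤ liminf (fun j : ℕ ↦ C * a ^ (-(ε₀ / ((j : ℝ) + 1)))) atTop := by
        refine liminf_le_liminf (Eventually.of_forall fun j ↦ h _ (by positivity) ?_)
        exact div_le_self hε₀.le (by linarith [(Nat.cast_nonneg j : (0 : ℝ) ≤ j)])
    _ = C := (key a C ha0 hat).liminf_eq

/-- Young's inequality for integral operators: a kernel whose marginal `L^s` norms are uniformly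
bounded maps `L^p` to `L^q` whenever `1 + 1/q = 1/p + 1/s`. -/
lemma lintegral_rpow_lintegral_mul_le {X Y : Type*} [MeasurableSpace X] [MeasurableSpace Y]
    {μ : Measure X} {ν : Measure Y} [SFinite μ] [SFinite ν]
    {k : X → Y → ℝ≥0∞} (hk : Measurable (Function.uncurry k))
    {f : Y → ℝ≥0∞} (hf : Measurable f) {p q s : ℝ} (hp : 1 ≤ p) (hq : 0 < q) (hs : 1 ≤ s)
    (hpqs : 1 + 1 / q = 1 / p + 1 / s) {C : ℝ≥0∞}
    (h1 : ∀ᵐ x ∂μ, ∫⁻ y, k x y ^ s ∂ν ≤ C) (h2 : ∀ᵐ y ∂ν, ∫⁻ x, k x y ^ s ∂μ ≤ C) :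
    (∫⁻ x, (∫⁻ y, k x y * f y ∂ν) ^ q ∂μ) ^ (1 / q)
      ≤ C ^ (1 / s) * (∫⁻ y, f y ^ p ∂ν) ^ (1 / p) := by
  have hp0 : 0 < p := by linarith
  have hs0 : 0 < s := by linarith
  have hq' : 0 ≤ 1 / q := by positivity
  have hp' : 0 ≤ 1 - 1 / p := by rw [sub_nonneg, div_le_one hp0]; exact hp
  have hs' : 1 / s ≤ 1 := by rw [div_le_one hs0]; exact hs
  have hpq : 0 ≤ 1 / p - 1 / q := by linarith
  set N := ∫⁻ y, f y ^ p ∂ν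
  set B := N ^ (1 / p - 1 / q) * C ^ (1 - 1 / p) with hB
  have hkx : ∀ x, Measurable (k x) := fun x ↦ hk.of_uncurry_left
  have hm2 : Measurable (Function.uncurry fun x y ↦ k x y ^ s * f y ^ p) :=
    (hk.pow_const s).mul ((hf.comp measurable_snd).pow_const p)
  have hptw : ∀ x y, k x y * f y
      = (k x y ^ s * f y ^ p) ^ (1 / q) * (f y ^ p) ^ (1 / p - 1 / q)
        * (k x y ^ s) ^ (1 - 1 / p) := by
    intro x y
    have ef : f y = (f y ^ p) ^ (1 / q) * (f y ^ p) ^ (1 / p - 1 / q) := by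
      rw [← ENNReal.rpow_add_of_nonneg _ _ hq' hpq, ← ENNReal.rpow_mul]
      have : p * (1 / q + (1 / p - 1 / q)) = 1 := by field_simp; ring
      rw [this, ENNReal.rpow_one]
    have ek : k x y = (k x y ^ s) ^ (1 / q) * (k x y ^ s) ^ (1 - 1 / p) := by
      rw [← ENNReal.rpow_add_of_nonneg _ _ hq' hp', ← ENNReal.rpow_mul]
      have : s * (1 / q + (1 - 1 / p)) = 1 := by
        rw [show 1 / q + (1 - 1 / p) = 1 / s by linarith]; field_simp
      rw [this, ENNReal.rpow_one]
    rw [ENNReal.mul_rpow_of_nonneg _ _ hq']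
    conv_lhs => rw [ef, ek]
    ring
  have hG : ∀ᵐ x ∂μ, (∫⁻ y, k x y * f y ∂ν) ^ q ≤ (∫⁻ y, k x y ^ s * f y ^ p ∂ν) * B ^ q := by
    filter_upwards [h1] with x hx
    have hH := ENNReal.lintegral_prod_norm_pow_le (μ := ν) (Finset.univ : Finset (Fin 3))
      (f := ![fun y ↦ k x y ^ s * f y ^ p, fun y ↦ f y ^ p, fun y ↦ k x y ^ s])
      (p := ![1 / q, 1 / p - 1 / q, 1 - 1 / p])
      (by
        intro i _
        fin_cases i
        · exact (((hkx x).pow_const s).mul (hf.pow_const p)).aemeasurable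
        · exact (hf.pow_const p).aemeasurable
        · exact ((hkx x).pow_const s).aemeasurable)
      (by simp [Fin.sum_univ_three])
      (by
        intro i _
        fin_cases i
        · exact hq'
        · exact hpq
        · exact hp')
    have hH' : ∫⁻ y, k x y * f y ∂ν ≤ (∫⁻ y, k x y ^ s * f y ^ p ∂ν) ^ (1 / q) * B := by
      calc ∫⁻ y, k x y * f y ∂ν
          ≤ (∫⁻ y, k x y ^ s * f y ^ p ∂ν) ^ (1 / q) * N ^ (1 / p - 1 / q)
            * (∫⁻ y, k x y ^ s ∂ν) ^ (1 - 1 / p) := by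
            simp_rw [hptw x]
            simpa [Fin.prod_univ_three] using hH
        _ ≤ _ := by
            rw [hB, ← mul_assoc]
            gcongr
    calc (∫⁻ y, k x y * f y ∂ν) ^ q ≤ ((∫⁻ y, k x y ^ s * f y ^ p ∂ν) ^ (1 / q) * B) ^ q := by
          gcongr
      _ = _ := by
          rw [ENNReal.mul_rpow_of_nonneg _ _ hq.le, ← ENNReal.rpow_mul, one_div_mul_cancel hq.ne',
            ENNReal.rpow_one]
  have hdouble : ∫⁻ x, ∫⁻ y, k x y ^ s * f y ^ p ∂ν ∂μ ≤ C * N := by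
    rw [lintegral_lintegral_swap hm2.aemeasurable, ← lintegral_const_mul _ (hf.pow_const p)]
    apply lintegral_mono_ae
    filter_upwards [h2] with y hy
    rw [lintegral_mul_const _ ((hk.of_uncurry_right).pow_const s)]
    gcongr
  calc (∫⁻ x, (∫⁻ y, k x y * f y ∂ν) ^ q ∂μ) ^ (1 / q)
      ≤ (C * N * B ^ q) ^ (1 / q) := by
        gcongr
        calc _ ≤ ∫⁻ x, (∫⁻ y, k x y ^ s * f y ^ p ∂ν) * B ^ q ∂μ := lintegral_mono_ae hG
          _ = (∫⁻ x, ∫⁻ y, k x y ^ s * f y ^ p ∂ν ∂μ) * B ^ q :=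
            lintegral_mul_const _ hm2.lintegral_prod_right
          _ ≤ _ := by gcongr
    _ = (C ^ (1 / q) * C ^ (1 - 1 / p)) * (N ^ (1 / q) * N ^ (1 / p - 1 / q)) := by
        rw [ENNReal.mul_rpow_of_nonneg _ _ hq', ENNReal.mul_rpow_of_nonneg _ _ hq',
          ← ENNReal.rpow_mul B, mul_one_div_cancel hq.ne', ENNReal.rpow_one, hB]
        ring
    _ = C ^ (1 / s) * N ^ (1 / p) := by
        rw [← ENNReal.rpow_add_of_nonneg _ _ hq' hp', ← ENNReal.rpow_add_of_nonneg _ _ hq' hpq]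
        congr 2 <;> linarith

/-- Abstract form of the `L^p(Ω, δ_Ω^γ) → L^q(Ω, δ_Ω^{γ'})` estimate for the
operator `Tf(z) = ∫_Ω K(z,ζ) f(ζ) dλ(ζ)`, where `K` satisfies the two weighted
integral estimates with exponent `1 + μ₀`, `μ₀ = (1 - m(γ-γ'))/(m(γ+n)+1)`,
and `1/q = 1/p - (1 - m(γ-γ'))/(m(γ'+n)+2)`. -/
theorem weighted_lp_lq_kernel_estimate {n : ℕ} (hn : 1 ≤ n)
    (Ω : Set (EuclideanSpace ℂ (Fin n)))
    [MeasurableSpace (EuclideanSpace ℂ (Fin n))]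
    [BorelSpace (EuclideanSpace ℂ (Fin n))]
    (hΩo : IsOpen Ω) (hΩb : Bornology.IsBounded Ω) (hΩne : Ω.Nonempty)
    (m γ γ' : ℝ) (hm : 0 < m) (hγ' : -1 < γ') (hγ'γ : γ' ≤ γ)
    (hγγ' : γ - γ' ≤ 1 / m)
    (μ₀ : ℝ) (hμ₀ : μ₀ = (1 - m * (γ - γ')) / (m * (γ + n) + 1))
    (K : EuclideanSpace ℂ (Fin n) → EuclideanSpace ℂ (Fin n) → ℂ)
    (hK : Measurable (Function.uncurry K))
    (ε₀ C : ℝ) (hε₀ : 0 < ε₀) (hC : 0 < C)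
    (h1 : ∀ ε : ℝ, 0 < ε → ε ≤ ε₀ → ∀ z ∈ Ω,
      (∫⁻ ζ in Ω, (‖K z ζ‖₊ : ℝ≥0∞) ^ (1 + μ₀) *
          ENNReal.ofReal (infDist ζ (frontier Ω)) ^ (-μ₀ * γ - ε))
        ≤ ENNReal.ofReal C * ENNReal.ofReal (infDist z (frontier Ω)) ^ (-ε))
    (h2 : ∀ ε : ℝ, 0 < ε → ε ≤ ε₀ → ∀ ζ ∈ Ω,
      (∫⁻ z in Ω, (‖K z ζ‖₊ : ℝ≥0∞) ^ (1 + μ₀) *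
          ENNReal.ofReal (infDist z (frontier Ω)) ^ (γ' - ε) *
          ENNReal.ofReal (infDist ζ (frontier Ω)) ^ (-(1 + μ₀) * γ))
        ≤ ENNReal.ofReal C * ENNReal.ofReal (infDist ζ (frontier Ω)) ^ (-ε))
    (p q : ℝ) (hp : 1 ≤ p)
    (hplt : p < (m * (γ' + n) + 2) / (1 - m * (γ - γ')))
    (hq : 1 / q = 1 / p - (1 - m * (γ - γ')) / (m * (γ' + n) + 2)) :
    ∃ C' > (0 : ℝ), ∀ f : EuclideanSpace ℂ (Fin n) → ℂ, Measurable f →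
      (∫⁻ ζ in Ω, (‖f ζ‖₊ : ℝ≥0∞) ^ p *
          ENNReal.ofReal (infDist ζ (frontier Ω)) ^ γ) < ⊤ →
      (∀ᵐ z ∂(volume.restrict Ω),
          (∫⁻ ζ in Ω, (‖K z ζ‖₊ : ℝ≥0∞) * (‖f ζ‖₊ : ℝ≥0∞)) < ⊤) ∧
      (∫⁻ z in Ω, (‖∫ ζ in Ω, K z ζ * f ζ‖₊ : ℝ≥0∞) ^ q *
          ENNReal.ofReal (infDist z (frontier Ω)) ^ γ') ^ (1 / q)
        ≤ ENNReal.ofReal C' *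
          (∫⁻ ζ in Ω, (‖f ζ‖₊ : ℝ≥0∞) ^ p *
            ENNReal.ofReal (infDist ζ (frontier Ω)) ^ γ) ^ (1 / p) := by
  have hn' : (1 : ℝ) ≤ n := by exact_mod_cast hn
  have hmγ : m * (γ - γ') ≤ 1 := by rwa [le_div_iff₀' hm] at hγγ'
  have hD : 0 < m * (γ' + n) + 2 := by nlinarith
  have hD' : 0 < m * (γ + n) + 1 := by nlinarith
  have ha : 0 < 1 - m * (γ - γ') := by
    rcases (sub_nonneg.2 hmγ).lt_or_eq with h | h
    · exact h
    · rw [← h, _root_.div_zero] at hplt; linarith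
  have hμpos : 0 ≤ μ₀ := by rw [hμ₀]; positivity
  have hs : 1 / (1 + μ₀) = 1 - (1 - m * (γ - γ')) / (m * (γ' + n) + 2) := by
    have : 1 + μ₀ = (m * (γ' + n) + 2) / (m * (γ + n) + 1) := by
      rw [hμ₀]; field_simp; ring
    rw [this]; field_simp; ring
  have hp0 : 0 < p := by linarith
  have hq0 : 0 < q := by
    have : 0 < 1 / q := by
      rw [hq, sub_pos, div_lt_div_iff₀ hD hp0]
      rw [lt_div_iff₀ ha] at hplt
      linarith
    exact one_div_pos.1 this
  have hpqs : 1 + 1 / q = 1 / p + 1 / (1 + μ₀) := by rw [hs, hq]; ring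
  have : Nonempty (Fin n) := ⟨⟨0, hn⟩⟩
  have hfr : (frontier Ω).Nonempty := by
    refine nonempty_frontier_iff.2 ⟨hΩne, ?_⟩
    rintro rfl
    exact NormedSpace.unbounded_univ ℂ (EuclideanSpace ℂ (Fin n)) hΩb
  have hδpos : ∀ z ∈ Ω, 0 < infDist z (frontier Ω) := by
    intro z hz
    refine (isClosed_frontier.notMem_iff_infDist_pos hfr).1 fun h ↦ ?_
    rw [hΩo.frontier_eq] at h
    exact h.2 hz
  set d : EuclideanSpace ℂ (Fin n) → ℝ≥0∞ := fun z ↦ ENNReal.ofReal (infDist z (frontier Ω)) with hd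
  have hdm : Measurable d := (continuous_infDist_pt _).measurable.ennreal_ofReal
  have hd0 : ∀ z ∈ Ω, d z ≠ 0 := fun z hz ↦ by simpa [hd] using hδpos z hz
  have hdt : ∀ z, d z ≠ ⊤ := fun z ↦ ENNReal.ofReal_ne_top
  have hΩm : MeasurableSet Ω := hΩo.measurableSet
  have hae : ∀ᵐ z ∂(volume.restrict Ω), z ∈ Ω := ae_restrict_mem hΩm
  have hKe : Measurable (Function.uncurry fun z ζ ↦ (‖K z ζ‖₊ : ℝ≥0∞)) := hK.enorm
  set k : EuclideanSpace ℂ (Fin n) → EuclideanSpace ℂ (Fin n) → ℝ≥0∞ := fun z ζ ↦ (‖K z ζ‖₊ : ℝ≥0∞) * d ζ ^ (-γ)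
  have hk : Measurable (Function.uncurry k) :=
    hKe.mul ((hdm.comp measurable_snd).pow_const _)
  set μ := (volume.restrict Ω).withDensity (fun z ↦ d z ^ γ') with hμ
  set ν := (volume.restrict Ω).withDensity (fun z ↦ d z ^ γ) with hν
  have hμi : ∀ g : EuclideanSpace ℂ (Fin n) → ℝ≥0∞, Measurable g → ∫⁻ z, g z ∂μ = ∫⁻ z in Ω, g z * d z ^ γ' := by
    intro g hg
    rw [hμ, lintegral_withDensity_eq_lintegral_mul _ (hdm.pow_const _) hg]
    simp only [Pi.mul_apply, mul_comm]
  have hνi : ∀ g : EuclideanSpace ℂ (Fin n) → ℝ≥0∞, Measurable g → ∫⁻ z, g z ∂ν = ∫⁻ z in Ω, g z * d z ^ γ := by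
    intro g hg
    rw [hν, lintegral_withDensity_eq_lintegral_mul _ (hdm.pow_const _) hg]
    simp only [Pi.mul_apply, mul_comm]
  have haeμ : ∀ᵐ z ∂μ, z ∈ Ω := withDensity_absolutelyContinuous _ _ hae
  have haeν : ∀ᵐ z ∂ν, z ∈ Ω := withDensity_absolutelyContinuous _ _ hae
  have hs0 : 0 ≤ 1 + μ₀ := by linarith
  have hk1 : ∀ᵐ z ∂μ, ∫⁻ ζ, k z ζ ^ (1 + μ₀) ∂ν ≤ ENNReal.ofReal C := by
    filter_upwards [haeμ] with z hz
    have hkz : Measurable fun ζ ↦ k z ζ ^ (1 + μ₀) := (hk.of_uncurry_left).pow_const _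
    refine lintegral_le_of_forall_lintegral_mul_rpow_neg_le hkz.aemeasurable hdm.aemeasurable
      (haeν.mono hd0) (ae_of_all _ hdt) (hd0 z hz) (hdt z) hε₀ fun ε hε hεle ↦ ?_
    refine le_trans (le_of_eq ?_) (h1 ε hε hεle z hz)
    refine (hνi _ (hkz.mul (hdm.pow_const (-ε)))).trans ?_
    refine setLIntegral_congr_fun hΩm fun ζ hζ ↦ ?_
    change ((‖K z ζ‖₊ : ℝ≥0∞) * d ζ ^ (-γ)) ^ (1 + μ₀) * d ζ ^ (-ε) * d ζ ^ γ
      = (‖K z ζ‖₊ : ℝ≥0∞) ^ (1 + μ₀) * d ζ ^ (-μ₀ * γ - ε)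
    rw [ENNReal.mul_rpow_of_nonneg _ _ hs0, ← ENNReal.rpow_mul, mul_assoc, mul_assoc,
      ← ENNReal.rpow_add _ _ (hd0 ζ hζ) (hdt ζ), ← ENNReal.rpow_add _ _ (hd0 ζ hζ) (hdt ζ)]
    congr 2
    ring
  have hk2 : ∀ᵐ ζ ∂ν, ∫⁻ z, k z ζ ^ (1 + μ₀) ∂μ ≤ ENNReal.ofReal C := by
    filter_upwards [haeν] with ζ hζ
    have hkz : Measurable fun z ↦ k z ζ ^ (1 + μ₀) := (hk.of_uncurry_right).pow_const _
    refine lintegral_le_of_forall_lintegral_mul_rpow_neg_le hkz.aemeasurable hdm.aemeasurable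
      (haeμ.mono hd0) (ae_of_all _ hdt) (hd0 ζ hζ) (hdt ζ) hε₀ fun ε hε hεle ↦ ?_
    refine le_trans (le_of_eq ?_) (h2 ε hε hεle ζ hζ)
    refine (hμi _ (hkz.mul (hdm.pow_const (-ε)))).trans ?_
    refine setLIntegral_congr_fun hΩm fun z hz ↦ ?_
    change ((‖K z ζ‖₊ : ℝ≥0∞) * d ζ ^ (-γ)) ^ (1 + μ₀) * d z ^ (-ε) * d z ^ γ'
      = (‖K z ζ‖₊ : ℝ≥0∞) ^ (1 + μ₀) * d z ^ (γ' - ε) * d ζ ^ (-(1 + μ₀) * γ)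
    rw [ENNReal.mul_rpow_of_nonneg _ _ hs0, ← ENNReal.rpow_mul, mul_assoc,
      ← ENNReal.rpow_add _ _ (hd0 z hz) (hdt z), show -ε + γ' = γ' - ε by ring,
      show -γ * (1 + μ₀) = -(1 + μ₀) * γ by ring]
    ring
  refine ⟨C ^ (1 / (1 + μ₀)), by positivity, fun f hf hfin ↦ ?_⟩
  have hfe : Measurable fun ζ ↦ (‖f ζ‖₊ : ℝ≥0∞) := hf.enorm
  have hyoung := lintegral_rpow_lintegral_mul_le (μ := μ) (ν := ν) hk hfe hp hq0
    (by linarith : 1 ≤ 1 + μ₀) hpqs hk1 hk2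
  have hinner : ∀ z, ∫⁻ ζ, k z ζ * (‖f ζ‖₊ : ℝ≥0∞) ∂ν
      = ∫⁻ ζ in Ω, (‖K z ζ‖₊ : ℝ≥0∞) * (‖f ζ‖₊ : ℝ≥0∞) := by
    intro z
    refine (hνi _ ((hk.of_uncurry_left (x := z)).mul hfe)).trans ?_
    refine setLIntegral_congr_fun hΩm fun ζ hζ ↦ ?_
    have h1 : d ζ ^ (-γ) * d ζ ^ γ = 1 := by
      rw [← ENNReal.rpow_add _ _ (hd0 ζ hζ) (hdt ζ)]; simp
    calc (‖K z ζ‖₊ : ℝ≥0∞) * d ζ ^ (-γ) * ‖f ζ‖₊ * d ζ ^ γ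
        = (‖K z ζ‖₊ : ℝ≥0∞) * ‖f ζ‖₊ * (d ζ ^ (-γ) * d ζ ^ γ) := by ring
      _ = _ := by rw [h1, mul_one]
  have hTm : Measurable fun z ↦ ∫⁻ ζ in Ω, (‖K z ζ‖₊ : ℝ≥0∞) * (‖f ζ‖₊ : ℝ≥0∞) :=
    Measurable.lintegral_prod_right (hKe.mul (hfe.comp measurable_snd))
  simp_rw [hinner] at hyoung
  rw [hνi _ (hfe.pow_const p), hμi _ (hTm.pow_const q),
    ENNReal.ofReal_rpow_of_pos hC] at hyoung
  refine ⟨?_, le_trans ?_ hyoung⟩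
  · have hlt : ∫⁻ z in Ω, (∫⁻ ζ in Ω, (‖K z ζ‖₊ : ℝ≥0∞) * (‖f ζ‖₊ : ℝ≥0∞)) ^ q * d z ^ γ' < ⊤ := by
      refine (ENNReal.rpow_lt_top_iff_of_pos (one_div_pos.2 hq0)).1 (hyoung.trans_lt ?_)
      exact ENNReal.mul_lt_top ENNReal.ofReal_lt_top
        (ENNReal.rpow_lt_top_of_nonneg (by positivity) hfin.ne)
    filter_upwards [ae_lt_top ((hTm.pow_const q).mul (hdm.pow_const γ')) hlt.ne, hae] with z hz hzΩ
    have h0 : d z ^ γ' ≠ 0 := by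
      simp [ENNReal.rpow_eq_zero_iff, hd0 z hzΩ, hdt z]
    exact (ENNReal.rpow_lt_top_iff_of_pos hq0).1
      (ENNReal.lt_top_of_mul_ne_top_left hz.ne h0)
  · gcongr with z
    refine (enorm_integral_le_lintegral_enorm _).trans (le_of_eq ?_)
    simp_rw [enorm_mul]
    rfl
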